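/- Let Ω ⊆ ℝⁿ be an open set and ω : Ω → [0,∞) a locally integrable weight. For every locally ω-integrable function u on Ω one has TV_ω(u,Ω) = TV_{ω^{sc⁻}}(u,Ω), where ω^{sc⁻} is the lower semicontinuous envelope of ω. -/

import Mathlib

open MeasureTheory Set Filter Topology
open scoped Classical ENNReal

noncomputable section

abbrev Euc (n : ℕ) := EuclideanSpace ℝ (Fin n)

/-- Divergence of a vector field via `fderiv` (valid a.e. for Lipschitz maps). -/
noncomputable def divg {n : ℕ} (φ : Euc n → Euc n) (x : Euc n) : ℝ :=
  ∑ i, fderiv ℝ φ x (EuclideanSpace.single i 1) i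

/-- Admissible test vector fields for the `ω`-weighted variation on `Ω`:
Lipschitz, compactly supported in (the interior of) `Ω`, pointwise bounded by `ω`. -/
def AdmVF {n : ℕ} (Ω : Set (Euc n)) (ω : Euc n → ℝ) (φ : Euc n → Euc n) : Prop :=
  (∃ K, LipschitzWith K φ) ∧ HasCompactSupport φ ∧ tsupport φ ⊆ interior Ω ∧
    ∀ x ∈ Ω, ‖φ x‖ ≤ ω x

/-- `ω`-weighted total variation `TV_ω(u, Ω)`. -/
noncomputable def TVw {n : ℕ} (Ω : Set (Euc n)) (ω : Euc n → ℝ) (u : Euc n → ℝ) : ℝ≥0∞ :=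
  ⨆ (φ : Euc n → Euc n) (_ : AdmVF Ω ω φ),
    ENNReal.ofReal (∫ x in Ω, u x * divg φ x)

/-- `u ∈ L¹_ω(Ω)`. -/
def MemL1w {n : ℕ} (Ω : Set (Euc n)) (ω : Euc n → ℝ) (u : Euc n → ℝ) : Prop :=
  IntegrableOn (fun x => |u x| * ω x) Ω

/-- `u ∈ L¹_{ω,loc}(Ω)`. -/
def MemL1wLoc {n : ℕ} (Ω : Set (Euc n)) (ω : Euc n → ℝ) (u : Euc n → ℝ) : Prop :=
  ∀ K, K ⊆ Ω → IsCompact K → IntegrableOn (fun x => |u x| * ω x) K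

/-- `u ∈ BV_ω(Ω)`. -/
def BVw {n : ℕ} (Ω : Set (Euc n)) (ω : Euc n → ℝ) (u : Euc n → ℝ) : Prop :=
  MemL1w Ω ω u ∧ TVw Ω ω u < ⊤

/-- `g` is the lower semicontinuous envelope of `ω` on `Ω`: the largest lower
semicontinuous function on `Ω` that is `≤ ω` pointwise on `Ω`. -/
def IsLscEnv {n : ℕ} (Ω : Set (Euc n)) (ω g : Euc n → ℝ) : Prop :=
  LowerSemicontinuousOn g Ω ∧ (∀ x ∈ Ω, g x ≤ ω x) ∧
    ∀ h : Euc n → ℝ, LowerSemicontinuousOn h Ω → (∀ x ∈ Ω, h x ≤ ω x) → ∀ x ∈ Ω, h x ≤ g x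

/-- The `ω`-admissible test fields are exactly those admissible for the lower semicontinuous
envelope, since `x ↦ ‖φ x‖` is continuous. -/
theorem admVF_iff_of_isLscEnv {n : ℕ} {Ω : Set (Euc n)} {ω g : Euc n → ℝ}
    (hg : IsLscEnv Ω ω g) (φ : Euc n → Euc n) : AdmVF Ω ω φ ↔ AdmVF Ω g φ := by
  obtain ⟨-, hle, hmax⟩ := hg
  constructor
  · rintro ⟨⟨K, hK⟩, hc, hs, hb⟩
    exact ⟨⟨K, hK⟩, hc, hs,
      hmax _ (hK.continuous.norm.lowerSemicontinuous.lowerSemicontinuousOn Ω) hb⟩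
  · rintro ⟨hK, hc, hs, hb⟩
    exact ⟨hK, hc, hs, fun x hx => (hb x hx).trans (hle x hx)⟩

/-- For every locally `ω`-integrable `u`, `TV_ω(u,Ω) = TV_{ω^{sc⁻}}(u,Ω)`,
where `ω^{sc⁻}` is the lower semicontinuous envelope of `ω`. -/
theorem TVw_eq_TVw_lscEnv {n : ℕ} (Ω : Set (Euc n)) (hΩ : IsOpen Ω)
    (ω : Euc n → ℝ) (hω0 : ∀ x ∈ Ω, 0 ≤ ω x)
    (hωloc : LocallyIntegrableOn ω Ω)
    (u : Euc n → ℝ) (hu : MemL1wLoc Ω ω u)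
    (g : Euc n → ℝ) (hg : IsLscEnv Ω ω g) :
    TVw Ω ω u = TVw Ω g u := by
  simp only [TVw, admVF_iff_of_isLscEnv hg]

end
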